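/- In AddMonoidAlgebra ℚ (ZMod 25), write t^k for the monomial supported at k ∈ ZMod 25 with coefficient 1, set σ = 2·(t^0 + t^5 + t^10 + t^15 + t^20), for each n : ℕ set Δ_n = n•σ·(1 + t + t^3) − 1 + t^2 − t^3 − t^8 + t^9 − t^11 + t^12 − t^13 + t^15 − t^16 − t^20 + t^21 − t^23 + t^24 (with t = t^1), let s_n ∈ ℚ be the sum of all coefficients of Δ_n, and let α = (1/25)·∑_{k ∈ ZMod 25} t^k. Then the sequence n ↦ (minimum over k ∈ ZMod 25 of the coefficient of t^k in Δ_n − s_n • α) tends to −∞ as n → ∞. -/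

import Mathlib

namespace KanenobuTorsion

/-- The monomial `t^k` in the rational group algebra `ℚ[ℤ/25ℤ]`. -/
noncomputable def t (k : ZMod 25) : AddMonoidAlgebra ℚ (ZMod 25) :=
  AddMonoidAlgebra.single k 1

/-- The element `σ = 2 (1 + t⁵ + t¹⁰ + t¹⁵ + t²⁰)` of `ℚ[ℤ/25ℤ]`. -/
noncomputable def σ : AddMonoidAlgebra ℚ (ZMod 25) :=
  2 * (t 0 + t 5 + t 10 + t 15 + t 20)

/-- The determinant `Δ_n^{44}` of the abelianized Fox minor for the double branched
cover `M_n` of the Kanenobu knot `K_{-10n, 10n+3}`, as an element of `ℚ[ℤ/25ℤ]`. -/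
noncomputable def Δ (n : ℕ) : AddMonoidAlgebra ℚ (ZMod 25) :=
  n • σ * (1 + t 1 + t 3) - 1 + t 2 - t 3 - t 8 + t 9 - t 11 + t 12 - t 13
    + t 15 - t 16 - t 20 + t 21 - t 23 + t 24

/-- The sum of the coefficients of `Δ_n` (the augmentation `φ₀(Δ_n)`). -/
noncomputable def s (n : ℕ) : ℚ := ∑ k : ZMod 25, (Δ n).coeff k

/-- The averaging idempotent `α = (1/25) ∑ₖ t^k` of `ℚ[ℤ/25ℤ]`. -/
noncomputable def α : AddMonoidAlgebra ℚ (ZMod 25) :=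
  (1 / 25 : ℚ) • ∑ k : ZMod 25, t k

theorem t_mul (a b : ZMod 25) : t a * t b = t (a + b) := by
  simp [t, AddMonoidAlgebra.single_mul_single]

theorem one_eq_t : (1 : AddMonoidAlgebra ℚ (ZMod 25)) = t 0 := rfl

theorem t_coeff (a k : ZMod 25) : (t a).coeff k = if a = k then 1 else 0 := by
  simp [t, AddMonoidAlgebra.coeff_single, Finsupp.single_apply]

theorem sum_t (a : ZMod 25) : ∑ k : ZMod 25, (t a).coeff k = 1 := by
  simp [t_coeff]

/-- The expanded form of `Δ n`. -/
theorem Δ_eq (n : ℕ) : Δ n = (2 * n : ℚ) •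
      (t 0 + t 5 + t 10 + t 15 + t 20 + (t 1 + t 6 + t 11 + t 16 + t 21)
        + (t 3 + t 8 + t 13 + t 18 + t 23))
      - t 0 + t 2 - t 3 - t 8 + t 9 - t 11 + t 12 - t 13
      + t 15 - t 16 - t 20 + t 21 - t 23 + t 24 := by
  have h : n • σ * (1 + t 1 + t 3) = (2 * n : ℚ) •
      (t 0 + t 5 + t 10 + t 15 + t 20 + (t 1 + t 6 + t 11 + t 16 + t 21)
        + (t 3 + t 8 + t 13 + t 18 + t 23)) := by
    have h2 : n • σ = (2 * n : ℚ) • (t 0 + t 5 + t 10 + t 15 + t 20) := by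
      rw [σ, two_mul, mul_comm, mul_smul, two_smul, Nat.cast_smul_eq_nsmul]
    rw [h2, one_eq_t, smul_mul_assoc]
    congr 1
    simp only [mul_add, add_mul, t_mul]
    norm_num
  rw [Δ, h, one_eq_t]

theorem s_eq (n : ℕ) : s n = 30 * n - 2 := by
  simp only [s, Δ_eq, AddMonoidAlgebra.coeff_add, AddMonoidAlgebra.coeff_sub,
    AddMonoidAlgebra.coeff_smul, Finsupp.add_apply, Finsupp.sub_apply, Finsupp.smul_apply,
    Finset.sum_add_distrib, Finset.sum_sub_distrib, ← Finset.mul_sum, sum_t, smul_eq_mul]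
  ring

theorem α_coeff (k : ZMod 25) : α.coeff k = 1 / 25 := by
  simp [α, AddMonoidAlgebra.coeff_sum, t_coeff]

theorem Δ_coeff_four (n : ℕ) : (Δ n).coeff 4 = 0 := by
  simp only [Δ_eq, AddMonoidAlgebra.coeff_add, AddMonoidAlgebra.coeff_sub,
    AddMonoidAlgebra.coeff_smul, Finsupp.add_apply, Finsupp.sub_apply, Finsupp.smul_apply,
    t_coeff]
  simp +decide

/-- The minimal coefficient of `Δ_n - φ₀(Δ_n) α`, which up to a fixed `n`-independent
automorphism of `ℚ[ℤ/25ℤ]` is the minimal Turaev torsion coefficient of `M_n`,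
tends to `-∞` as `n → ∞`. -/
theorem min_torsion_coefficient_tendsto_atBot :
    Filter.Tendsto
      (fun n : ℕ => Finset.univ.inf' Finset.univ_nonempty
        (fun k : ZMod 25 => (Δ n - s n • α).coeff k))
      Filter.atTop Filter.atBot := by
  have hlim : Filter.Tendsto (fun n : ℕ => (2 / 25 : ℚ) + (-(6 / 5) : ℚ) * (n : ℚ))
      Filter.atTop Filter.atBot :=
    Filter.tendsto_atBot_add_const_left _ _
      (Filter.Tendsto.const_mul_atTop_of_neg (by norm_num) tendsto_natCast_atTop_atTop)
  refine Filter.tendsto_atBot_mono (fun n => ?_) hlim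
  refine (Finset.inf'_le _ (Finset.mem_univ (4 : ZMod 25))).trans (le_of_eq ?_)
  rw [AddMonoidAlgebra.coeff_sub, AddMonoidAlgebra.coeff_smul, Finsupp.sub_apply,
    Finsupp.smul_apply, Δ_coeff_four, α_coeff, s_eq, smul_eq_mul]
  ring

end KanenobuTorsion
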